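/- Let n ≥ 1 and k ≥ 1 be integers, Q = [−1,1] × [0,1]^(n−1) ⊂ ℝⁿ, and let h, g : ℝⁿ → ℝ be positive C^k functions such that h(x) = g(x) for all x ∈ ∂Q, ∫_Q h dx = ∫_Q g dx, and ∫_{[0,1]ⁿ} h dx = ∫_{[0,1]ⁿ} g dx. Then there exists a C^k diffeomorphism u : ℝⁿ → ℝⁿ such that g(u(x)) · det(Du(x)) = h(x) for all x ∈ Q. Furthermore, if h − g ≡ 0 on a neighborhood of ∂Q, then u can be chosen so that u equals the identity on a neighborhood of ∂Q. -/

import Mathlib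

open Set MeasureTheory

/-- The double cube `Q = [-1,1] × [0,1]^m ⊂ ℝ × ℝ^m`. -/
def doubleCube (m : ℕ) : Set (ℝ × (Fin m → ℝ)) :=
  Set.Icc (-1 : ℝ) 1 ×ˢ Set.Icc (0 : Fin m → ℝ) 1

/-- The right-hand unit subcube `[0,1] × [0,1]^m` of the double cube. -/
def rightCube (m : ℕ) : Set (ℝ × (Fin m → ℝ)) :=
  Set.Icc (0 : ℝ) 1 ×ˢ Set.Icc (0 : Fin m → ℝ) 1

theorem contDiff_intervalIntegral_param {E : Type} [NormedAddCommGroup E] [NormedSpace ℝ E]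
    [FiniteDimensional ℝ E] (k : ℕ) (a b : ℝ) :
    ∀ {F : Type} [NormedAddCommGroup F] [NormedSpace ℝ F] [CompleteSpace F] {f : E × ℝ → F},
      ContDiff ℝ k f → ContDiff ℝ k (fun x => ∫ t in a..b, f (x, t)) := by
  induction k with
  | zero =>
    intro F _ _ _ f hf
    rw [Nat.cast_zero, contDiff_zero] at hf ⊢
    exact intervalIntegral.continuous_parametric_intervalIntegral_of_continuous'
      (f := fun x t => f (x, t)) hf a b
  | succ k ih =>
    intro F _ _ _ f hf
    have hf1 : ContDiff ℝ k (fun p => (fderiv ℝ f p).comp (ContinuousLinearMap.inl ℝ E ℝ)) := by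
      have : ContDiff ℝ k (fderiv ℝ f) := hf.fderiv_right (by norm_cast)
      exact this.clm_comp contDiff_const
    have hfd : Differentiable ℝ f := hf.differentiable (by norm_cast)
    push_cast
    rw [contDiff_succ_iff_hasFDerivAt (𝕜 := ℝ)]
    refine ⟨_, ih hf1, fun x₀ => ?_⟩
    have := FiniteDimensional.proper ℝ E
    obtain ⟨C, hC⟩ := ((isCompact_closedBall x₀ 1).prod
      (isCompact_uIcc (a := a) (b := b))).exists_bound_of_continuousOn hf1.continuous.continuousOn
    refine intervalIntegral.hasFDerivAt_integral_of_dominated_of_fderiv_le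
      (μ := volume) (𝕜 := ℝ) (bound := fun _ => C) (Metric.closedBall_mem_nhds x₀ one_pos)
      (F := fun x t => f (x, t))
      (F' := fun x t => (fderiv ℝ f (x, t)).comp (ContinuousLinearMap.inl ℝ E ℝ))
      ?_ ?_ ?_ ?_ ?_ ?_
    · exact Filter.Eventually.of_forall fun x =>
        (hf.continuous.comp (by fun_prop : Continuous fun t : ℝ => (x, t))).aestronglyMeasurable
    · exact (hf.continuous.comp
        (by fun_prop : Continuous fun t : ℝ => (x₀, t))).intervalIntegrable _ _
    · exact (hf1.continuous.comp
        (by fun_prop : Continuous fun t : ℝ => (x₀, t))).aestronglyMeasurable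
    · exact Filter.Eventually.of_forall fun t ht x hx => hC (x, t) ⟨hx, uIoc_subset_uIcc ht⟩
    · exact intervalIntegrable_const
    · refine Filter.Eventually.of_forall fun t _ x _ => ?_
      exact (hfd (x, t)).hasFDerivAt.comp x (hasFDerivAt_prodMk_left x t)

theorem contDiff_intervalIntegral_upper {E : Type} [NormedAddCommGroup E] [NormedSpace ℝ E]
    [FiniteDimensional ℝ E] {k : ℕ} {f : E × ℝ → ℝ} (hf : ContDiff ℝ k f) {b : E → ℝ}
    (hb : ContDiff ℝ k b) (a : ℝ) : ContDiff ℝ k (fun x => ∫ t in a..b x, f (x, t)) := by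
  have key : (fun x => ∫ t in a..b x, f (x, t)) =
      fun x => (b x - a) * ∫ s in (0 : ℝ)..1, f (x, a + (b x - a) * s) := by
    ext x
    have := intervalIntegral.smul_integral_comp_add_mul (a := 0) (b := 1)
      (fun t => f (x, t)) (b x - a) a
    rw [smul_eq_mul] at this
    rw [this]
    simp
  rw [key]
  refine (hb.sub contDiff_const).mul (contDiff_intervalIntegral_param k 0 1
    (f := fun p : E × ℝ => f (p.1, a + (b p.1 - a) * p.2)) (hf.comp ?_))
  have := hb.comp (contDiff_fst (𝕜 := ℝ) (E := E) (F := ℝ) (n := k))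
  exact contDiff_fst.prodMk (contDiff_const.add ((this.sub contDiff_const).mul contDiff_snd))

/-- The primitive of `f` in the `i`-th coordinate, based at `p`. -/
noncomputable def linePrimitive {n : ℕ} (f : (Fin n → ℝ) → ℝ) (i : Fin n) (p : ℝ)
    (x : Fin n → ℝ) : ℝ :=
  ∫ t in p..x i, f (Function.update x i t)

/-- The map replacing the `i`-th coordinate by the primitive of `f` along it. -/
noncomputable def lineMap {n : ℕ} (f : (Fin n → ℝ) → ℝ) (i : Fin n) (p : ℝ)
    (x : Fin n → ℝ) : Fin n → ℝ :=
  Function.update x i (linePrimitive f i p x)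

theorem contDiff_update_comp {n : ℕ} {E : Type*} [NormedAddCommGroup E] [NormedSpace ℝ E]
    {k : WithTop ℕ∞} {φ : E → Fin n → ℝ} {ψ : E → ℝ} (hφ : ContDiff ℝ k φ) (hψ : ContDiff ℝ k ψ)
    (i : Fin n) : ContDiff ℝ k (fun x => Function.update (φ x) i (ψ x)) := by
  rw [contDiff_pi] at hφ ⊢
  intro j
  rcases eq_or_ne j i with rfl | hj
  · simpa using hψ
  · simpa [Function.update_of_ne hj] using hφ j

theorem contDiff_comp_update {n : ℕ} {k : WithTop ℕ∞} {f : (Fin n → ℝ) → ℝ}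
    (hf : ContDiff ℝ k f) (i : Fin n) :
    ContDiff ℝ k (fun p : (Fin n → ℝ) × ℝ => f (Function.update p.1 i p.2)) :=
  hf.comp (contDiff_update_comp contDiff_fst contDiff_snd i)

theorem contDiff_linePrimitive {n k : ℕ} {f : (Fin n → ℝ) → ℝ} (hf : ContDiff ℝ k f)
    (i : Fin n) (p : ℝ) : ContDiff ℝ k (linePrimitive f i p) :=
  contDiff_intervalIntegral_upper (contDiff_comp_update hf i) (contDiff_apply ℝ ℝ i) p

theorem contDiff_lineMap {n k : ℕ} {f : (Fin n → ℝ) → ℝ} (hf : ContDiff ℝ k f)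
    (i : Fin n) (p : ℝ) : ContDiff ℝ k (lineMap f i p) :=
  contDiff_update_comp contDiff_id (contDiff_linePrimitive hf i p) i

theorem continuous_line {n : ℕ} {f : (Fin n → ℝ) → ℝ} (hf : Continuous f) (i : Fin n)
    (x : Fin n → ℝ) : Continuous fun t => f (Function.update x i t) :=
  hf.comp (continuous_const.update i continuous_id)

theorem fderiv_linePrimitive_single {n k : ℕ} (hk : 1 ≤ k) {f : (Fin n → ℝ) → ℝ}
    (hf : ContDiff ℝ k f) (i : Fin n) (p : ℝ) (x : Fin n → ℝ) :
    fderiv ℝ (linePrimitive f i p) x (Pi.single i 1) = f x := by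
  have hd : HasFDerivAt (linePrimitive f i p) (fderiv ℝ (linePrimitive f i p) x)
      (Function.update x i (x i)) := by
    rw [Function.update_eq_self]
    exact ((contDiff_linePrimitive hf i p).differentiable
      (by exact_mod_cast (by omega : k ≠ 0)) x).hasFDerivAt
  have h1 := hd.comp_hasDerivAt (x i) (hasDerivAt_update x i (x i))
  have h2 : HasDerivAt (fun s => ∫ t in p..s, f (Function.update x i t)) (f x) (x i) := by
    have := (continuous_line hf.continuous i x).integral_hasStrictDerivAt p (x i)
    simpa using this.hasDerivAt
  refine h1.unique (h2.congr_of_eventuallyEq (Filter.Eventually.of_forall fun s => ?_))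
  simp [linePrimitive]

theorem det_eq_of_eq_update {n : ℕ} (i : Fin n) (A : (Fin n → ℝ) →ₗ[ℝ] (Fin n → ℝ))
    (L : (Fin n → ℝ) → ℝ) (hA : ∀ v, A v = Function.update v i (L v)) :
    LinearMap.det A = L (Pi.single i 1) := by
  have : LinearMap.toMatrix' A = (1 : Matrix (Fin n) (Fin n) ℝ).updateRow i
      (fun j => L (Pi.single j 1)) := by
    ext j l
    rw [LinearMap.toMatrix'_apply, hA]
    rcases eq_or_ne j i with rfl | hj
    · simp
    · simp [Function.update_of_ne hj, Matrix.updateRow_ne hj, Matrix.one_apply, Pi.single_apply]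
  rw [← LinearMap.det_toMatrix', this, ← Matrix.cramer_transpose_apply]
  simp

theorem det_fderiv_lineMap {n k : ℕ} (hk : 1 ≤ k) {f : (Fin n → ℝ) → ℝ}
    (hf : ContDiff ℝ k f) (i : Fin n) (p : ℝ) (x : Fin n → ℝ) :
    LinearMap.det (fderiv ℝ (lineMap f i p) x).toLinearMap = f x := by
  have hk0 : (k : WithTop ℕ∞) ≠ 0 := by exact_mod_cast (by omega : k ≠ 0)
  rw [← fderiv_linePrimitive_single hk hf i p x]
  refine det_eq_of_eq_update i _ (fderiv ℝ (linePrimitive f i p) x) fun v => ?_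
  ext j
  have hd := ((contDiff_lineMap hf i p).differentiable hk0 x).hasFDerivAt
  have hj := hasFDerivAt_pi'.1 hd j
  rcases eq_or_ne j i with rfl | hji
  · have h2 := ((contDiff_linePrimitive hf j p).differentiable hk0 x).hasFDerivAt
    simp only [lineMap, Function.update_self] at hj
    have := congrArg (fun T => T v) (hj.unique h2)
    simpa using this
  · simp only [lineMap, Function.update_of_ne hji] at hj
    have := congrArg (fun T => T v) (hj.unique (hasFDerivAt_apply j x))
    simpa [Function.update_of_ne hji] using this

theorem line_integral_growth {n : ℕ} {f : (Fin n → ℝ) → ℝ} (hf : Continuous f) {c : ℝ}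
    (hfc : ∀ x, c ≤ f x) (i : Fin n) (p : ℝ) (x : Fin n → ℝ) {s s' : ℝ} (hs : s ≤ s') :
    c * (s' - s) ≤ (∫ t in p..s', f (Function.update x i t)) -
      ∫ t in p..s, f (Function.update x i t) := by
  have hc := continuous_line hf i x
  rw [intervalIntegral.integral_interval_sub_left (hc.intervalIntegrable _ _)
    (hc.intervalIntegrable _ _)]
  have := intervalIntegral.integral_mono_on hs (intervalIntegrable_const (c := c))
    (hc.intervalIntegrable (μ := volume) s s') (fun t _ => hfc (Function.update x i t))
  simpa [mul_comm] using this

theorem bijective_lineMap {n : ℕ} {f : (Fin n → ℝ) → ℝ} (hf : Continuous f) {c : ℝ} (hc : 0 < c)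
    (hfc : ∀ x, c ≤ f x) (i : Fin n) (p : ℝ) : Function.Bijective (lineMap f i p) := by
  constructor
  · intro x y hxy
    have hne : ∀ j ≠ i, x j = y j := fun j hj => by
      have := congrFun hxy j
      simpa [lineMap, Function.update_of_ne hj] using this
    have hy : ∀ t, Function.update y i t = Function.update x i t := fun t => by
      ext j
      rcases eq_or_ne j i with rfl | hj
      · simp
      · simp [Function.update_of_ne hj, hne j hj]
    have hi := congrFun hxy i
    simp only [lineMap, Function.update_self, linePrimitive, hy] at hi
    ext j
    rcases eq_or_ne j i with rfl | hj
    · rcases le_total (x j) (y j) with h | h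
      · have := line_integral_growth hf hfc j p x h
        nlinarith
      · have := line_integral_growth hf hfc j p x h
        nlinarith
    · exact hne j hj
  · intro y
    have hcont : Continuous fun s => ∫ t in p..s, f (Function.update y i t) :=
      intervalIntegral.continuous_primitive
        (fun a b => (continuous_line hf i y).intervalIntegrable a b) p
    have htop : Filter.Tendsto (fun s => ∫ t in p..s, f (Function.update y i t))
        Filter.atTop Filter.atTop := by
      refine Filter.tendsto_atTop_mono' _ (f₁ := fun s => c * (s - p)) ?_ ?_
      · filter_upwards [Filter.eventually_ge_atTop p] with s hs
        simpa using line_integral_growth hf hfc i p y hs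
      · exact (Filter.tendsto_atTop_add_const_right _ (-p) Filter.tendsto_id).const_mul_atTop hc
    have hbot : Filter.Tendsto (fun s => ∫ t in p..s, f (Function.update y i t))
        Filter.atBot Filter.atBot := by
      refine Filter.tendsto_atBot_mono' _ (f₁ := fun s => c * (s - p)) ?_ ?_
      · filter_upwards [Filter.eventually_le_atBot p] with s hs
        have := line_integral_growth hf hfc i p y hs
        simp only [intervalIntegral.integral_same] at this
        linarith
      · exact (Filter.tendsto_atBot_add_const_right _ (-p) Filter.tendsto_id).const_mul_atBot hc
    obtain ⟨s, hs⟩ := hcont.surjective htop hbot (y i)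
    refine ⟨Function.update y i s, ?_⟩
    simp only at hs
    simp [lineMap, linePrimitive, hs]

theorem contDiff_inverse_of_bijective {E : Type*} [NormedAddCommGroup E] [NormedSpace ℝ E]
    [FiniteDimensional ℝ E] {k : ℕ} (hk : 1 ≤ k) {u : E → E} (hu : ContDiff ℝ k u)
    (hb : Function.Bijective u) (hdet : ∀ x, LinearMap.det (fderiv ℝ u x).toLinearMap ≠ 0) :
    ∃ w, ContDiff ℝ k w ∧ Function.LeftInverse w u ∧ Function.RightInverse w u := by
  have hk0 : (k : WithTop ℕ∞) ≠ 0 := by exact_mod_cast (by omega : k ≠ 0)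
  have : CompleteSpace E := FiniteDimensional.complete ℝ E
  have hopen : IsOpenMap u := isOpenMap_of_hasStrictFDerivAt_equiv
    (f' := fun x => (fderiv ℝ u x).toContinuousLinearEquivOfDetNeZero (hdet x))
    fun x => by simpa using hu.contDiffAt.hasStrictFDerivAt hk0
  let e : E ≃ₜ E := (Equiv.ofBijective u hb).toHomeomorphOfContinuousOpen hu.continuous hopen
  refine ⟨e.symm, e.contDiff_symm
    (f₀' := fun x => (fderiv ℝ u x).toContinuousLinearEquivOfDetNeZero (hdet x))
    (fun x => ?_) hu, e.symm_apply_apply, e.apply_symm_apply⟩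
  change HasFDerivAt u _ x
  simpa using (hu.differentiable hk0 x).hasFDerivAt

/-- `f` is the pull-back density of `f'` under a `C^k` diffeomorphism that is the identity
outside `B`. -/
def Transports {E : Type*} [NormedAddCommGroup E] [NormedSpace ℝ E] (k : ℕ) (B : Set E)
    (f f' : E → ℝ) : Prop :=
  ∃ u : E → E, ContDiff ℝ k u ∧
    (∃ w, ContDiff ℝ k w ∧ Function.LeftInverse w u ∧ Function.RightInverse w u) ∧
    (∀ x, f' (u x) * LinearMap.det (fderiv ℝ u x).toLinearMap = f x) ∧ ∀ x ∉ B, u x = x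

theorem Transports.refl {E : Type*} [NormedAddCommGroup E] [NormedSpace ℝ E] (k : ℕ) (B : Set E)
    (f : E → ℝ) : Transports k B f f :=
  ⟨id, contDiff_id, ⟨id, contDiff_id, fun _ => rfl, fun _ => rfl⟩, fun x => by simp,
    fun _ _ => rfl⟩

theorem Transports.trans {E : Type*} [NormedAddCommGroup E] [NormedSpace ℝ E] {k : ℕ}
    (hk : 1 ≤ k) {B : Set E} {f₁ f₂ f₃ : E → ℝ} (h₁ : Transports k B f₁ f₂)
    (h₂ : Transports k B f₂ f₃) : Transports k B f₁ f₃ := by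
  obtain ⟨u, hu, ⟨w, hw, hwu, huw⟩, hdet, hid⟩ := h₁
  obtain ⟨u', hu', ⟨w', hw', hwu', huw'⟩, hdet', hid'⟩ := h₂
  have hk0 : (k : WithTop ℕ∞) ≠ 0 := by exact_mod_cast (by omega : k ≠ 0)
  refine ⟨u' ∘ u, hu'.comp hu, ⟨w ∘ w', hw.comp hw', hwu'.comp hwu, huw'.comp huw⟩,
    fun x => ?_, fun x hx => ?_⟩
  · rw [fderiv_comp x (hu'.differentiable hk0 _) (hu.differentiable hk0 x), ← hdet x,
      ← hdet' (u x), ContinuousLinearMap.toLinearMap_comp, LinearMap.det_comp, Function.comp_apply]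
    ring
  · rw [Function.comp_apply, hid x hx, hid' x hx]

theorem integral_line_eq_zero {n : ℕ} {a b : Fin n → ℝ} {d : (Fin n → ℝ) → ℝ}
    (hd : ∀ x ∉ Icc a b, d x = 0) (i : Fin n) (x : Fin n → ℝ) {p q : ℝ}
    (hpq : ∀ t ∈ uIoo p q, Function.update x i t ∉ Icc a b) :
    ∫ t in p..q, d (Function.update x i t) = 0 := by
  rw [intervalIntegral.integral_congr_uIoo (g := fun _ => 0) fun t ht => hd _ (hpq t ht)]
  simp

theorem linePrimitive_eq_zero {n : ℕ} {a b : Fin n → ℝ} {d : (Fin n → ℝ) → ℝ}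
    (hdc : Continuous d) (hd : ∀ x ∉ Icc a b, d x = 0) (i : Fin n)
    (hint : ∀ x, ∫ t in a i..b i, d (Function.update x i t) = 0)
    {x : Fin n → ℝ} (hx : x ∉ Icc a b) : linePrimitive d i (a i) x = 0 := by
  have hx' : ∃ j, x j < a j ∨ b j < x j := by
    by_contra! h
    exact hx ⟨fun j => (h j).1, fun j => (h j).2⟩
  obtain ⟨j, hj⟩ := hx'
  unfold linePrimitive
  rcases eq_or_ne j i with rfl | hji
  · rcases hj with hj | hj
    · refine integral_line_eq_zero hd j x fun t ht hmem => ?_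
      rw [uIoo_of_ge hj.le] at ht
      have := hmem.1 j
      simp only [Function.update_self] at this
      exact this.not_gt ht.2
    · rw [← intervalIntegral.integral_add_adjacent_intervals
        ((continuous_line hdc j x).intervalIntegrable (a j) (b j))
        ((continuous_line hdc j x).intervalIntegrable (b j) (x j)), hint, zero_add]
      refine integral_line_eq_zero hd j x fun t ht hmem => ?_
      rw [uIoo_of_le hj.le] at ht
      have := hmem.2 j
      simp only [Function.update_self] at this
      exact this.not_gt ht.1
  · refine integral_line_eq_zero hd i x fun t _ hmem => ?_
    have h1 := hmem.1 j
    have h2 := hmem.2 j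
    simp only [Function.update_of_ne hji] at h1 h2
    rcases hj with hj | hj <;> linarith

theorem transports_of_line_integral_eq_zero {n k : ℕ} (hk : 1 ≤ k) {a b : Fin n → ℝ}
    {f f' : (Fin n → ℝ) → ℝ} (hf : ContDiff ℝ k f) (hf' : ContDiff ℝ k f') {c : ℝ} (hc : 0 < c)
    (hfc : ∀ x, c ≤ f x) (hfc' : ∀ x, c ≤ f' x) (i : Fin n)
    (hd : ∀ x ∉ Icc a b, f x = f' x)
    (hint : ∀ x, ∫ t in a i..b i, (f (Function.update x i t) - f' (Function.update x i t)) = 0) :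
    Transports k (Icc a b) f f' := by
  have hk0 : (k : WithTop ℕ∞) ≠ 0 := by exact_mod_cast (by omega : k ≠ 0)
  have hb := bijective_lineMap hf.continuous hc hfc i (a i)
  have hb' := bijective_lineMap hf'.continuous hc hfc' i (a i)
  have hdet := det_fderiv_lineMap hk hf i (a i)
  have hdet' := det_fderiv_lineMap hk hf' i (a i)
  have hu := contDiff_lineMap hf i (a i)
  have hu' := contDiff_lineMap hf' i (a i)
  obtain ⟨w, hw, hwu, huw⟩ := contDiff_inverse_of_bijective hk hu hb
    fun x => by rw [hdet]; exact (hc.trans_le (hfc x)).ne'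
  obtain ⟨w', hw', hwu', huw'⟩ := contDiff_inverse_of_bijective hk hu' hb'
    fun x => by rw [hdet']; exact (hc.trans_le (hfc' x)).ne'
  have hcomp : lineMap f' i (a i) ∘ (w' ∘ lineMap f i (a i)) = lineMap f i (a i) := by
    ext1 x
    exact huw' _
  refine ⟨w' ∘ lineMap f i (a i), hw'.comp hu, ⟨w ∘ lineMap f' i (a i), hw.comp hu',
    fun x => ?_, fun x => ?_⟩, fun x => ?_, fun x hx => ?_⟩
  · rw [Function.comp_apply, Function.comp_apply, huw', hwu]
  · rw [Function.comp_apply, Function.comp_apply, huw, hwu']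
  · have h1 := hdet x
    rw [← hcomp, fderiv_comp x (hu'.differentiable hk0 _) ((hw'.comp hu).differentiable hk0 x),
      ContinuousLinearMap.toLinearMap_comp, LinearMap.det_comp, hdet'] at h1
    exact h1
  · have : lineMap f i (a i) x = lineMap f' i (a i) x := by
      have h0 := linePrimitive_eq_zero (hf.continuous.sub hf'.continuous)
        (fun y hy => sub_eq_zero.2 (hd y hy)) i hint hx
      unfold lineMap
      congr 1
      rw [← sub_eq_zero, ← h0]
      exact (intervalIntegral.integral_sub
        ((continuous_line hf.continuous i x).intervalIntegrable _ _)
        ((continuous_line hf'.continuous i x).intervalIntegrable _ _)).symm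
    rw [Function.comp_apply, this, hwu']

theorem exists_pos_bound {E : Type*} [TopologicalSpace E] {B : Set E} (hB : IsCompact B)
    {d : E → ℝ} (hdc : Continuous d) (hd : ∀ x ∉ B, d x = 0) : ∃ M > 0, ∀ x, |d x| ≤ M := by
  obtain ⟨M, hM⟩ := hB.exists_bound_of_continuousOn hdc.continuousOn
  refine ⟨max M 1, by positivity, fun x => ?_⟩
  by_cases hx : x ∈ B
  · exact (hM x hx).trans (le_max_left _ _)
  · rw [hd x hx, abs_zero]
    positivity

/-- Every density bounded below can be perturbed by a small multiple of `d` within its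
transport class. -/
def SmallTransport {n : ℕ} (k : ℕ) (a b : Fin n → ℝ) (d : (Fin n → ℝ) → ℝ) : Prop :=
  ∀ c > 0, ∃ ε > 0, ∀ s ∈ Icc 0 ε, ∀ f : (Fin n → ℝ) → ℝ, ContDiff ℝ k f → (∀ x, c ≤ f x) →
    Transports k (Icc a b) (fun x => f x + s * d x) f

theorem le_add_mul_of_abs_le {c M s y z : ℝ} (hM : 0 < M) (hs : s ∈ Icc 0 (c / 2 / M))
    (hy : c ≤ y) (hz : |z| ≤ M) : c / 2 ≤ y + s * z := by
  have h1 : s * M ≤ c / 2 := by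
    have := mul_le_mul_of_nonneg_right hs.2 hM.le
    rwa [div_mul_cancel₀ _ hM.ne'] at this
  have h2 : s * -M ≤ s * z := mul_le_mul_of_nonneg_left (abs_le.1 hz).1 hs.1
  linarith

theorem smallTransport_of_line_integral_eq_zero {n k : ℕ} (hk : 1 ≤ k) {a b : Fin n → ℝ}
    {d : (Fin n → ℝ) → ℝ} (hdc : ContDiff ℝ k d) (hd : ∀ x ∉ Icc a b, d x = 0) (i : Fin n)
    (hint : ∀ x, ∫ t in a i..b i, d (Function.update x i t) = 0) : SmallTransport k a b d := by
  intro c hc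
  obtain ⟨M, hM, hdM⟩ := exists_pos_bound isCompact_Icc hdc.continuous hd
  refine ⟨c / 2 / M, by positivity, fun s hs f hf hfc => ?_⟩
  refine transports_of_line_integral_eq_zero hk (hf.add (contDiff_const.mul hdc)) hf (half_pos hc)
    (fun x => le_add_mul_of_abs_le hM hs (hfc x) (hdM x)) (fun x => by linarith [hfc x]) i
    (fun x hx => by simp [hd x hx]) fun x => ?_
  simp [hint x]

theorem SmallTransport.add {n k : ℕ} (hk : 1 ≤ k) {a b : Fin n → ℝ}
    {d₁ d₂ : (Fin n → ℝ) → ℝ} (hdc : ContDiff ℝ k d₁) (hd : ∀ x ∉ Icc a b, d₁ x = 0)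
    (h₁ : SmallTransport k a b d₁) (h₂ : SmallTransport k a b d₂) :
    SmallTransport k a b (fun x => d₁ x + d₂ x) := by
  intro c hc
  obtain ⟨M, hM, hdM⟩ := exists_pos_bound isCompact_Icc hdc.continuous hd
  obtain ⟨ε₁, hε₁, H₁⟩ := h₁ c hc
  obtain ⟨ε₂, hε₂, H₂⟩ := h₂ (c / 2) (half_pos hc)
  refine ⟨min (c / 2 / M) (min ε₁ ε₂), by positivity, fun s hs f hf hfc => ?_⟩
  have hs1 : s ∈ Icc 0 (c / 2 / M) := ⟨hs.1, hs.2.trans (min_le_left _ _)⟩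
  have hs2 : s ∈ Icc 0 ε₁ := ⟨hs.1, hs.2.trans ((min_le_right _ _).trans (min_le_left _ _))⟩
  have hs3 : s ∈ Icc 0 ε₂ := ⟨hs.1, hs.2.trans ((min_le_right _ _).trans (min_le_right _ _))⟩
  have := (H₂ s hs3 _ (hf.add (contDiff_const.mul hdc))
    fun x => le_add_mul_of_abs_le hM hs1 (hfc x) (hdM x)).trans hk (H₁ s hs2 f hf hfc)
  refine (congrArg (fun F => Transports k (Icc a b) F f) ?_).mp this
  ext x
  ring

/-- Redistribute the mass of `d` on lines parallel to the `i`-th axis with profile `ρ i`. -/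
noncomputable def redistribute {n : ℕ} (ρ : Fin n → ℝ → ℝ) (a b : Fin n → ℝ) (i : Fin n)
    (d : (Fin n → ℝ) → ℝ) (x : Fin n → ℝ) : ℝ :=
  ρ i (x i) * ∫ t in a i..b i, d (Function.update x i t)

section Redistribute

variable {n k : ℕ} {ρ : Fin n → ℝ → ℝ} {a b : Fin n → ℝ} {d : (Fin n → ℝ) → ℝ}

theorem contDiff_redistribute (hρ : ∀ i, ContDiff ℝ k (ρ i)) (hdc : ContDiff ℝ k d) (i : Fin n) :
    ContDiff ℝ k (redistribute ρ a b i d) :=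
  ((hρ i).comp (contDiff_apply ℝ ℝ i)).mul
    (contDiff_intervalIntegral_param k _ _ (contDiff_comp_update hdc i))

theorem redistribute_eq_zero (hρ0 : ∀ i, ∀ t ∉ Icc (a i) (b i), ρ i t = 0)
    (hd : ∀ x ∉ Icc a b, d x = 0) (i : Fin n) {x : Fin n → ℝ} (hx : x ∉ Icc a b) :
    redistribute ρ a b i d x = 0 := by
  unfold redistribute
  by_cases hi : x i ∈ Icc (a i) (b i)
  · rw [integral_line_eq_zero hd i x, mul_zero]
    refine fun t _ hmem => hx ⟨fun j => ?_, fun j => ?_⟩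
    · rcases eq_or_ne j i with rfl | hj
      · exact hi.1
      · simpa [Function.update_of_ne hj] using hmem.1 j
    · rcases eq_or_ne j i with rfl | hj
      · exact hi.2
      · simpa [Function.update_of_ne hj] using hmem.2 j
  · rw [hρ0 i _ hi, zero_mul]

theorem SmallTransport.of_redistribute (hk : 1 ≤ k) (hρ : ∀ i, ContDiff ℝ k (ρ i))
    (hρ0 : ∀ i, ∀ t ∉ Icc (a i) (b i), ρ i t = 0) (hρ1 : ∀ i, ∫ t in a i..b i, ρ i t = 1)
    (hdc : ContDiff ℝ k d) (hd : ∀ x ∉ Icc a b, d x = 0) (i : Fin n)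
    (h : SmallTransport k a b (redistribute ρ a b i d)) : SmallTransport k a b d := by
  have hrc := contDiff_redistribute (a := a) (b := b) hρ hdc i
  have hsub : ∀ x ∉ Icc a b, d x - redistribute ρ a b i d x = 0 := fun x hx => by
    rw [hd x hx, redistribute_eq_zero hρ0 hd i hx, sub_zero]
  have h0 : SmallTransport k a b (fun x => d x - redistribute ρ a b i d x) := by
    refine smallTransport_of_line_integral_eq_zero hk (hdc.sub hrc) hsub i fun x => ?_
    rw [intervalIntegral.integral_sub ((continuous_line hdc.continuous i x).intervalIntegrable _ _)
      ((continuous_line hrc.continuous i x).intervalIntegrable _ _)]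
    simp [redistribute, hρ1]
  simpa using h0.add hk (hdc.sub hrc) hsub h

theorem integrable_of_eq_zero_off {E : Type*} [TopologicalSpace E] [MeasurableSpace E]
    [OpensMeasurableSpace E] [T2Space E] {μ : Measure E} [IsFiniteMeasureOnCompacts μ]
    {B : Set E} (hB : IsCompact B)
    {d : E → ℝ} (hdc : Continuous d) (hd : ∀ x ∉ B, d x = 0) : Integrable d μ :=
  hdc.integrable_of_hasCompactSupport (HasCompactSupport.intro hB hd)

theorem integral_line_eq (hd : ∀ x ∉ Icc a b, d x = 0) (i : Fin n) (hab : a i ≤ b i)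
    (x : Fin n → ℝ) :
    ∫ t, d (Function.update x i t) = ∫ t in a i..b i, d (Function.update x i t) := by
  rw [intervalIntegral.integral_of_le hab, ← integral_Icc_eq_integral_Ioc,
    setIntegral_eq_integral_of_forall_compl_eq_zero]
  refine fun t ht => hd _ fun hmem => ht ⟨?_, ?_⟩
  · simpa using hmem.1 i
  · simpa using hmem.2 i

end Redistribute

theorem integral_eq_integral_insertNth {n : ℕ} {a b : Fin (n + 1) → ℝ}
    {d : (Fin (n + 1) → ℝ) → ℝ} (hdc : Continuous d) (hd : ∀ x ∉ Icc a b, d x = 0)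
    (i : Fin (n + 1)) :
    ∫ x, d x = ∫ y : Fin n → ℝ, ∫ t, d (i.insertNth t y) := by
  have hmp := (volume_preserving_piFinSuccAbove (fun _ : Fin (n + 1) => ℝ) i).symm
  have hint : Integrable (fun z : ℝ × (Fin n → ℝ) => d (i.insertNth z.1 z.2))
      (volume.prod volume) :=
    hmp.integrable_comp_of_integrable (integrable_of_eq_zero_off isCompact_Icc hdc hd)
  rw [← hmp.integral_comp' d]
  exact integral_prod_symm _ hint

theorem integral_redistribute {n k : ℕ} {ρ : Fin (n + 1) → ℝ → ℝ} {a b : Fin (n + 1) → ℝ}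
    {d : (Fin (n + 1) → ℝ) → ℝ} (hρ : ∀ i, ContDiff ℝ k (ρ i))
    (hρ0 : ∀ i, ∀ t ∉ Icc (a i) (b i), ρ i t = 0) (hρ1 : ∀ i, ∫ t, ρ i t = 1)
    (hab : ∀ i, a i ≤ b i)
    (hdc : ContDiff ℝ k d) (hd : ∀ x ∉ Icc a b, d x = 0) (i : Fin (n + 1)) :
    ∫ x, redistribute ρ a b i d x = ∫ x, d x := by
  rw [integral_eq_integral_insertNth hdc.continuous hd i,
    integral_eq_integral_insertNth (contDiff_redistribute hρ hdc i).continuous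
      (fun x hx => redistribute_eq_zero hρ0 hd i hx) i]
  congr 1
  ext y
  have := integral_line_eq hd i (hab i) (i.insertNth 0 y)
  simp only [Fin.update_insertNth] at this
  simp only [redistribute, Fin.insertNth_apply_same, Fin.update_insertNth, ← this,
    integral_mul_const, hρ1, one_mul]

section Separation

variable {n : ℕ} {ρ : Fin n → ℝ → ℝ} {a b : Fin n → ℝ} {d : (Fin n → ℝ) → ℝ}

theorem redistribute_separates (i : Fin n) (x : Fin n → ℝ) (s : ℝ) :
    redistribute ρ a b i d x * ρ i s =
      redistribute ρ a b i d (Function.update x i s) * ρ i (x i) := by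
  simp [redistribute]
  ring

theorem redistribute_preserves_separation {j : Fin n}
    (hj : ∀ x s, d x * ρ j s = d (Function.update x j s) * ρ j (x j)) (i : Fin n)
    (x : Fin n → ℝ) (s : ℝ) :
    redistribute ρ a b i d x * ρ j s =
      redistribute ρ a b i d (Function.update x j s) * ρ j (x j) := by
  rcases eq_or_ne j i with rfl | hji
  · exact redistribute_separates j x s
  · simp only [redistribute, Function.update_of_ne hji.symm, mul_assoc,
      ← intervalIntegral.integral_mul_const]
    congr 2
    ext t
    rw [hj _ s, Function.update_of_ne hji, Function.update_comm hji]

theorem mul_prod_eq_of_separates (hj : ∀ j x s, d x * ρ j s = d (Function.update x j s) * ρ j (x j))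
    (x y : Fin n → ℝ) : d x * ∏ i, ρ i (y i) = d y * ∏ i, ρ i (x i) := by
  have key : ∀ S : Finset (Fin n), d x * ∏ i ∈ S, ρ i (y i) =
      d (S.piecewise y x) * ∏ i ∈ S, ρ i (x i) := by
    intro S
    induction S using Finset.induction_on with
    | empty => simp
    | insert i S hi ih =>
      have h1 := hj i (S.piecewise y x) (y i)
      rw [Finset.piecewise_eq_of_notMem _ _ _ hi] at h1
      rw [Finset.prod_insert hi, Finset.prod_insert hi, Finset.piecewise_insert,
        mul_left_comm, ih, ← mul_assoc, mul_comm (ρ i (y i)), h1, mul_assoc]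
  simpa using key Finset.univ

end Separation

theorem smallTransport_zero {n : ℕ} (k : ℕ) (a b : Fin n → ℝ) :
    SmallTransport k a b (fun _ => 0) := fun _ _ =>
  ⟨1, one_pos, fun s _ f _ _ => by simpa using Transports.refl k (Icc a b) f⟩

theorem exists_unit_mass_bump {a b : ℝ} (hab : a < b) :
    ∃ ρ : ℝ → ℝ, (∀ k : ℕ, ContDiff ℝ k ρ) ∧ (∀ t ∉ Icc a b, ρ t = 0) ∧ ∫ t, ρ t = 1 := by
  let B : ContDiffBump ((a + b) / 2) := ⟨(b - a) / 4, (b - a) / 2, by linarith, by linarith⟩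
  refine ⟨B.normed volume, fun k => B.contDiff_normed (n := (k : ℕ∞)), fun t ht => ?_,
    B.integral_normed⟩
  rw [← Function.notMem_support, B.support_normed_eq, Real.ball_eq_Ioo]
  change t ∉ Ioo ((a + b) / 2 - (b - a) / 2) ((a + b) / 2 + (b - a) / 2)
  exact fun h => ht ⟨by linarith [h.1], by linarith [h.2]⟩

theorem smallTransport_of_integral_eq_zero {n k : ℕ} (hk : 1 ≤ k) {a b : Fin (n + 1) → ℝ}
    (hab : ∀ i, a i < b i) {d : (Fin (n + 1) → ℝ) → ℝ} (hdc : ContDiff ℝ k d)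
    (hd : ∀ x ∉ Icc a b, d x = 0) (hint : ∫ x, d x = 0) : SmallTransport k a b d := by
  choose ρ hρ hρ0 hρ1 using fun i => exists_unit_mass_bump (hab i)
  have hρk : ∀ i, ContDiff ℝ k (ρ i) := fun i => hρ i k
  have hρ1' : ∀ i, ∫ t in a i..b i, ρ i t = 1 := fun i => by
    rw [← hρ1 i, intervalIntegral.integral_of_le (hab i).le, ← integral_Icc_eq_integral_Ioc,
      setIntegral_eq_integral_of_forall_compl_eq_zero (hρ0 i)]
  have key : ∀ (S : Finset (Fin (n + 1))) (d : (Fin (n + 1) → ℝ) → ℝ), ContDiff ℝ k d →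
      (∀ x ∉ Icc a b, d x = 0) → ∫ x, d x = 0 →
      (∀ j ∉ S, ∀ x s, d x * ρ j s = d (Function.update x j s) * ρ j (x j)) →
      SmallTransport k a b d := by
    intro S
    induction S using Finset.induction_on with
    | empty =>
      intro d hdc hd hint hsep
      have h0 : d = fun _ => 0 := by
        ext x
        have h1 : ∫ y : Fin (n + 1) → ℝ, d x * ∏ i, ρ i (y i) = ∫ y, d y * ∏ i, ρ i (x i) := by
          congr 1
          ext y
          exact mul_prod_eq_of_separates (fun j => hsep j (Finset.notMem_empty j)) x y
        rw [integral_const_mul, integral_mul_const, hint, integral_fintype_prod_volume_eq_prod] at h1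
        simpa [hρ1] using h1
      rw [h0]
      exact smallTransport_zero k a b
    | insert i S hi ih =>
      intro d hdc hd hint hsep
      refine SmallTransport.of_redistribute hk hρk hρ0 hρ1' hdc hd i
        (ih _ (contDiff_redistribute hρk hdc i) (fun x hx => redistribute_eq_zero hρ0 hd i hx)
          ?_ fun j hj => ?_)
      · rw [integral_redistribute hρk hρ0 hρ1 (fun i => (hab i).le) hdc hd i, hint]
      · rcases eq_or_ne j i with rfl | hji
        · exact redistribute_separates j
        · exact redistribute_preserves_separation
            (hsep j fun h => (Finset.mem_insert.1 h).elim hji hj) i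
  exact key Finset.univ d hdc hd hint fun j hj => absurd (Finset.mem_univ j) hj

theorem SmallTransport.transports {n k : ℕ} (hk : 1 ≤ k) {a b : Fin n → ℝ}
    {d g : (Fin n → ℝ) → ℝ} (h : SmallTransport k a b d) (hdc : ContDiff ℝ k d)
    (hg : ContDiff ℝ k g) {c : ℝ} (hc : 0 < c) (hgc : ∀ x, c ≤ g x)
    (hgd : ∀ x, c ≤ g x + d x) : Transports k (Icc a b) (fun x => g x + d x) g := by
  obtain ⟨ε, hε, H⟩ := h c hc
  obtain ⟨N, hN⟩ := exists_nat_one_div_lt hε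
  have hN0 : (0 : ℝ) < N + 1 := by positivity
  have key : ∀ j : ℕ, j ≤ N + 1 →
      Transports k (Icc a b) (fun x => g x + (j / (N + 1) : ℝ) * d x) g := by
    intro j
    induction j with
    | zero => intro _; simpa using Transports.refl k (Icc a b) g
    | succ j ih =>
      intro hj
      have hj' : (j / (N + 1) : ℝ) ≤ 1 := by
        rw [div_le_one hN0]
        exact_mod_cast (by omega : j ≤ N + 1)
      have hj0 : (0 : ℝ) ≤ j / (N + 1) := by positivity
      have := (H (1 / (N + 1)) ⟨by positivity, hN.le⟩ _
        (hg.add (contDiff_const (c := (j / (N + 1) : ℝ)).mul hdc))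
        fun x => by nlinarith [hgc x, hgd x]).trans hk (ih (by omega))
      refine (congrArg (fun F => Transports k (Icc a b) F g) ?_).mp this
      ext x
      push_cast
      ring
  have := key (N + 1) le_rfl
  push_cast at this
  simpa [div_self hN0.ne'] using this

theorem Transports.of_eqOn {E : Type*} [NormedAddCommGroup E] [NormedSpace ℝ E] {k : ℕ}
    {B : Set E} (hB : IsClosed B) {f f' F F' : E → ℝ} (h : Transports k B f f')
    (hf : EqOn f F B) (hf' : EqOn f' F' B) (hF : ∀ x ∉ B, F x = F' x) : Transports k B F F' := by
  obtain ⟨u, hu, ⟨w, hw, hwu, huw⟩, hdet, hid⟩ := h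
  refine ⟨u, hu, ⟨w, hw, hwu, huw⟩, fun x => ?_, hid⟩
  by_cases hx : x ∈ B
  · have hux : u x ∈ B := by
      by_contra hux
      rw [hwu.injective (hid _ hux)] at hux
      exact hux hx
    rw [← hf' hux, hdet, hf hx]
  · have : u =ᶠ[nhds x] id := by
      filter_upwards [hB.isOpen_compl.mem_nhds hx] with y hy using hid y hy
    rw [this.fderiv_eq, hid x hx, fderiv_id, hF x hx]
    simp

theorem exists_lower_bound {E : Type*} [TopologicalSpace E] {B : Set E} (hB : IsCompact B)
    {g : E → ℝ} (hg : Continuous g) (hpos : ∀ x, 0 < g x) : ∃ c > 0, ∀ x ∈ B, c ≤ g x := by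
  rcases B.eq_empty_or_nonempty with rfl | hne
  · exact ⟨1, one_pos, by simp⟩
  · obtain ⟨x, -, hx⟩ := hB.exists_isMinOn hne hg.continuousOn
    exact ⟨g x, hpos x, fun y hy => hx hy⟩

theorem transports_of_integral_eq_zero {n k : ℕ} (hk : 1 ≤ k) {a b : Fin (n + 1) → ℝ}
    (hab : ∀ i, a i < b i) {d g : (Fin (n + 1) → ℝ) → ℝ} (hdc : ContDiff ℝ k d)
    (hg : ContDiff ℝ k g) (hgpos : ∀ x, 0 < g x) (hgdpos : ∀ x, 0 < g x + d x)
    (hd : ∀ x ∉ Icc a b, d x = 0) (hint : ∫ x, d x = 0) :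
    Transports k (Icc a b) (fun x => g x + d x) g := by
  obtain ⟨R, hR, hBR⟩ := (isCompact_Icc (a := a) (b := b)).isBounded.subset_closedBall_lt 0 0
  let χ : ContDiffBump (0 : Fin (n + 1) → ℝ) := ⟨R, R + 1, hR, by linarith⟩
  have hχ1 : ∀ x ∈ Icc a b, χ x = 1 := fun x hx => χ.one_of_mem_closedBall (hBR hx)
  obtain ⟨c₁, hc₁, hgc⟩ := exists_lower_bound (isCompact_closedBall 0 (R + 1)) hg.continuous hgpos
  obtain ⟨c₂, hc₂, hgdc⟩ := exists_lower_bound (isCompact_closedBall 0 (R + 1))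
    (hg.continuous.add hdc.continuous) hgdpos
  have hlow : ∀ x, min c₁ 1 ≤ χ x * g x + (1 - χ x) := fun x => by
    have h0 := χ.nonneg (x := x)
    have h1 := χ.le_one (x := x)
    by_cases hx : x ∈ Metric.closedBall 0 (R + 1)
    · have h2 := (min_le_left c₁ 1).trans (hgc x hx)
      have h3 := min_le_right c₁ 1
      nlinarith
    · have : χ x = 0 := χ.zero_of_le_dist (not_le.1 hx).le
      simp [this]
  have hχc : ContDiff ℝ k χ := χ.contDiff
  have := (smallTransport_of_integral_eq_zero hk hab hdc hd hint).transports hk hdc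
    (g := fun x => χ x * g x + (1 - χ x)) ((hχc.mul hg).add (contDiff_const.sub hχc))
    (c := min c₂ (min c₁ 1)) (by positivity) (fun x => (min_le_right _ _).trans (hlow x))
    (fun x => by
      by_cases hx : x ∈ Icc a b
      · have := (min_le_left c₂ (min c₁ 1)).trans
          (hgdc x (Metric.closedBall_subset_closedBall (by linarith) (hBR hx)))
        simpa [hχ1 x hx] using this
      · rw [hd x hx, add_zero]
        exact (min_le_right _ _).trans (hlow x))
  exact this.of_eqOn isClosed_Icc (fun x hx => by simp [hχ1 x hx]) (fun x hx => by simp [hχ1 x hx])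
    fun x hx => by simp [hd x hx]

theorem Transports.comp_equiv {E F : Type*} [NormedAddCommGroup E] [NormedSpace ℝ E]
    [NormedAddCommGroup F] [NormedSpace ℝ F] {k : ℕ} (hk : 1 ≤ k) (e : E ≃L[ℝ] F) {B : Set F}
    {f f' : F → ℝ} (h : Transports k B f f') : Transports k (e ⁻¹' B) (f ∘ e) (f' ∘ e) := by
  obtain ⟨u, hu, ⟨w, hw, hwu, huw⟩, hdet, hid⟩ := h
  have hk0 : (k : WithTop ℕ∞) ≠ 0 := by exact_mod_cast (by omega : k ≠ 0)
  refine ⟨fun x => e.symm (u (e x)), e.symm.contDiff.comp (hu.comp e.contDiff),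
    ⟨fun x => e.symm (w (e x)), e.symm.contDiff.comp (hw.comp e.contDiff), fun x => ?_,
      fun x => ?_⟩, fun x => ?_, fun x hx => ?_⟩
  · simp [hwu _]
  · simp [huw _]
  · have hd : HasFDerivAt (fun x => e.symm (u (e x)))
        ((e.symm : F →L[ℝ] E).comp ((fderiv ℝ u (e x)).comp (e : E →L[ℝ] F))) x :=
      e.symm.hasFDerivAt.comp x
        (((hu.differentiable hk0 (e x)).hasFDerivAt).comp x e.hasFDerivAt)
    rw [hd.fderiv]
    have := LinearMap.det_conj (fderiv ℝ u (e x)).toLinearMap e.symm.toLinearEquiv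
    simp only [Function.comp_apply, ContinuousLinearEquiv.apply_symm_apply]
    rw [← hdet (e x), ← this]
    rfl
  · simp [hid _ hx]

theorem transports_prod_of_integral_eq_zero {m k : ℕ} (hk : 1 ≤ k) {a b : ℝ × (Fin m → ℝ)}
    (hab₁ : a.1 < b.1) (hab₂ : ∀ i, a.2 i < b.2 i) {d g : ℝ × (Fin m → ℝ) → ℝ}
    (hdc : ContDiff ℝ k d) (hg : ContDiff ℝ k g) (hgpos : ∀ x, 0 < g x)
    (hgdpos : ∀ x, 0 < g x + d x) (hd : ∀ x ∉ Icc a b, d x = 0) (hint : ∫ x, d x = 0) :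
    Transports k (Icc a b) (fun x => g x + d x) g := by
  let e : (ℝ × (Fin m → ℝ)) ≃L[ℝ] (Fin (m + 1) → ℝ) := Fin.consEquivL ℝ (fun _ => ℝ)
  have hmp := (volume_preserving_piFinSuccAbove (fun _ : Fin (m + 1) => ℝ) 0)
  have hsymm : ∀ x, e.symm x = MeasurableEquiv.piFinSuccAbove (fun _ => ℝ) 0 x := fun x => rfl
  have hbox : ∀ x, e x ∈ Icc (e a) (e b) ↔ x ∈ Icc a b := fun x => by
    have hle : ∀ y z, e y ≤ e z ↔ y ≤ z := fun y z => by
      change (Fin.cons y.1 y.2 : Fin (m + 1) → ℝ) ≤ Fin.cons z.1 z.2 ↔ _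
      rw [Fin.cons_le_cons, Prod.le_def]
    rw [mem_Icc, mem_Icc, hle, hle]
  have h := transports_of_integral_eq_zero hk (a := e a) (b := e b)
    (d := d ∘ e.symm) (g := g ∘ e.symm) (Fin.cases hab₁ hab₂) (hdc.comp e.symm.contDiff)
    (hg.comp e.symm.contDiff) (fun x => hgpos _) (fun x => hgdpos _)
    (fun x hx => hd _ fun hmem => hx (by simpa using (hbox _).2 hmem))
    (by
      rw [← hint]
      exact hmp.integral_comp' d)
  have h2 := h.comp_equiv hk e
  have h3 : e ⁻¹' Icc (e a) (e b) = Icc a b := by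
    ext x
    exact hbox x
  rw [h3] at h2
  refine (congrArg₂ (Transports k (Icc a b)) ?_ ?_).mp h2 <;> ext x <;> simp

theorem doubleCube_eq_Icc (m : ℕ) : doubleCube m = Icc (-1, 0) (1, 1) :=
  Icc_prod_Icc _ _ _ _

theorem isCompact_doubleCube (m : ℕ) : IsCompact (doubleCube m) :=
  doubleCube_eq_Icc m ▸ isCompact_Icc

theorem norm_le_one_of_mem_doubleCube {m : ℕ} {x : ℝ × (Fin m → ℝ)} (hx : x ∈ doubleCube m) :
    ‖x‖ ≤ 1 := by
  rw [norm_prod_le_iff, Real.norm_eq_abs, abs_le, pi_norm_le_iff_of_nonneg zero_le_one]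
  refine ⟨hx.1, fun i => ?_⟩
  have h0 : 0 ≤ x.2 i := hx.2.1 i
  have h1 : x.2 i ≤ 1 := hx.2.2 i
  rw [Real.norm_eq_abs, abs_le]
  exact ⟨by linarith, h1⟩

theorem mem_Icc_of_norm_le {m : ℕ} {R : ℝ} {x : ℝ × (Fin m → ℝ)} (hx : ‖x‖ ≤ R) :
    x ∈ Icc ((-R, fun _ => -R) : ℝ × (Fin m → ℝ)) (R, fun _ => R) := by
  have h1 := abs_le.1 ((norm_fst_le x).trans hx)
  have h2 := fun i => abs_le.1 (((norm_le_pi_norm x.2 i).trans (norm_snd_le x)).trans hx)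
  exact ⟨⟨h1.1, fun i => (h2 i).1⟩, ⟨h1.2, fun i => (h2 i).2⟩⟩

theorem integral_indicator_sub_eq_zero {E : Type*} [TopologicalSpace E] [MeasurableSpace E]
    [OpensMeasurableSpace E] [T2Space E] [SecondCountableTopology E] {μ : Measure E}
    [IsFiniteMeasureOnCompacts μ] {Q : Set E} (hQ : IsCompact Q) {h g : E → ℝ}
    (hh : Continuous h) (hg : Continuous g) (hint : ∫ x in Q, h x ∂μ = ∫ x in Q, g x ∂μ) :
    ∫ x, Q.indicator (fun x => h x - g x) x ∂μ = 0 := by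
  rw [integral_indicator hQ.measurableSet, integral_sub (hh.continuousOn.integrableOn_compact hQ)
    (hg.continuousOn.integrableOn_compact hQ), hint, sub_self]

open scoped Manifold in
theorem exists_smooth_cutoff {E : Type*} [NormedAddCommGroup E] [NormedSpace ℝ E]
    [FiniteDimensional ℝ E] {s U : Set E} (hs : IsClosed s) (hU : IsOpen U) (hsU : s ⊆ U)
    (k : ℕ) : ∃ χ : E → ℝ, ContDiff ℝ k χ ∧ (∀ x ∈ s, χ x = 1) ∧ (∀ x ∉ U, χ x = 0) ∧
      ∀ x, χ x ∈ Icc 0 1 := by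
  obtain ⟨χ, hχ, hr, h0, h1⟩ := exists_contMDiff_zero_iff_one_iff_of_isClosed (n := (k : ℕ∞)) 𝓘(ℝ, E)
    hU.isClosed_compl hs (disjoint_compl_left_iff_subset.2 hsU)
  exact ⟨χ, hχ.contDiff, fun x hx => (h1 x).1 hx,
    fun x hx => (h0 x).1 hx, fun x => hr ⟨x, rfl⟩⟩

theorem exists_compact_correction {m k : ℕ} {h g : ℝ × (Fin m → ℝ) → ℝ}
    (hh : ContDiff ℝ k h) (hg : ContDiff ℝ k g) (hhpos : ∀ x, 0 < h x) (hgpos : ∀ x, 0 < g x)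
    (hint : ∫ x in doubleCube m, h x = ∫ x in doubleCube m, g x) :
    ∃ d : ℝ × (Fin m → ℝ) → ℝ, ContDiff ℝ k d ∧ (∀ x, 10 < ‖x‖ → d x = 0) ∧
      (∀ x, 0 < g x + d x) ∧ (∀ x ∈ doubleCube m, g x + d x = h x) ∧ ∫ x, d x = 0 := by
  have hQ := isCompact_doubleCube m
  let p : ℝ × (Fin m → ℝ) := (5, 0)
  have hp : ‖p‖ = 5 := by simp [p]
  let ψ : ContDiffBump p := ⟨1 / 2, 1, by norm_num, by norm_num⟩
  have hψ0 : ∀ x, ψ x ≠ 0 → dist x p < 1 := fun x hx => by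
    by_contra! hle
    exact hx (ψ.zero_of_le_dist hle)
  have hψnorm : ∀ x, ψ x ≠ 0 → 4 < ‖x‖ ∧ ‖x‖ < 6 := fun x hx => by
    have h1 := hψ0 x hx
    rw [dist_eq_norm] at h1
    have h2 := abs_le.1 (abs_norm_sub_norm_le x p)
    constructor <;> linarith [h2.1, h2.2]
  have hI : 0 < ∫ x, ψ x := ψ.integral_pos
  obtain ⟨c, hc, hgc⟩ := exists_lower_bound (isCompact_closedBall p 1) hg.continuous hgpos
  obtain ⟨M₀, hM₀⟩ := (isCompact_closedBall (0 : ℝ × (Fin m → ℝ)) 2).exists_bound_of_continuousOn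
    (hh.continuous.sub hg.continuous).continuousOn
  let M := max M₀ 1
  have hM : 0 < M := by positivity
  have hε : 0 < c * (∫ x, ψ x) / (2 * M) := by positivity
  obtain ⟨U₀, hQU₀, hU₀, hvol⟩ := hQ.exists_isOpen_lt_add (μ := volume)
    (ENNReal.ofReal_pos.2 hε).ne'
  let U := U₀ ∩ Metric.ball 0 2
  have hU : IsOpen U := hU₀.inter Metric.isOpen_ball
  have hQU : doubleCube m ⊆ U := fun x hx => ⟨hQU₀ hx, by
    rw [mem_ball_zero_iff]
    linarith [norm_le_one_of_mem_doubleCube hx]⟩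
  have hvolU : volume.real (U \ doubleCube m) ≤ c * (∫ x, ψ x) / (2 * M) := by
    refine ENNReal.toReal_le_of_le_ofReal hε.le ?_
    refine (measure_mono (sdiff_subset_sdiff_left inter_subset_left)).trans ?_
    rw [measure_sdiff hQU₀ hQ.measurableSet.nullMeasurableSet hQ.measure_lt_top.ne]
    exact tsub_le_iff_left.2 hvol.le
  obtain ⟨χ, hχ, hχ1, hχ0, hχr⟩ := exists_smooth_cutoff hQ.isClosed hU hQU k
  have hχnorm : ∀ x, 2 ≤ ‖x‖ → χ x = 0 := fun x hx => hχ0 x fun hxU => by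
    have := mem_ball_zero_iff.1 hxU.2
    linarith
  let D := fun x => χ x * (h x - g x)
  have hD : ContDiff ℝ k D := hχ.mul (hh.sub hg)
  have hDint : Integrable D := integrable_of_eq_zero_off (isCompact_closedBall 0 2) hD.continuous
    fun x hx => by
      have : χ x = 0 := hχnorm x (by simpa using (not_le.1 (mem_closedBall_zero_iff.not.1 hx)).le)
      simp [D, this]
  have hQint : Integrable ((doubleCube m).indicator fun x => h x - g x) :=
    ((hh.continuous.sub hg.continuous).continuousOn.integrableOn_compact hQ).integrable_indicator
      hQ.measurableSet
  have hDsmall : |∫ x, D x| ≤ c * (∫ x, ψ x) / 2 := by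
    have h1 : ∫ x, D x = ∫ x in U \ doubleCube m, D x := by
      rw [← sub_zero (∫ x, D x), ← integral_indicator_sub_eq_zero hQ hh.continuous hg.continuous hint,
        ← integral_sub hDint hQint, ← integral_indicator (hU.measurableSet.diff hQ.measurableSet)]
      congr 1
      ext x
      by_cases hxQ : x ∈ doubleCube m
      · simp [D, hxQ, hχ1 x hxQ]
      · by_cases hxU : x ∈ U
        · simp [hxQ, hxU]
        · simp [D, hxQ, hxU, hχ0 x hxU]
    have hfin : volume (U \ doubleCube m) < ⊤ :=
      (measure_mono (sdiff_subset.trans inter_subset_right)).trans_lt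
        Metric.isBounded_ball.measure_lt_top
    have h2 : ‖∫ x in U \ doubleCube m, D x‖ ≤ M * volume.real (U \ doubleCube m) := by
      refine norm_setIntegral_le_of_norm_le_const hfin fun x hx => ?_
      have h3 := (hM₀ x (Metric.ball_subset_closedBall hx.1.2)).trans (le_max_left _ 1)
      rw [norm_mul, Real.norm_of_nonneg (hχr x).1]
      exact (mul_le_of_le_one_left (norm_nonneg _) (hχr x).2).trans h3
    rw [h1]
    refine (h2.trans (mul_le_mul_of_nonneg_left hvolU hM.le)).trans_eq ?_
    field_simp
  let s := -(∫ x, D x) / ∫ x, ψ x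
  have hs : |s| ≤ c / 2 := by
    rw [abs_div, abs_neg, abs_of_pos hI, div_le_iff₀ hI]
    linarith
  have hψc : ContDiff ℝ k ψ := ψ.contDiff
  refine ⟨fun x => D x + s * ψ x, hD.add (contDiff_const.mul hψc), fun x hx => ?_, fun x => ?_,
    fun x hx => ?_, ?_⟩
  · have h1 : ψ x = 0 := by
      by_contra hne
      linarith [hψnorm x hne]
    simp [D, h1, hχnorm x (by linarith)]
  · by_cases hne : ψ x = 0
    · have h1 := hχr x
      have h2 : 0 < (1 - χ x) * g x + χ x * h x := by
        rcases h1.1.eq_or_lt with h0 | h0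
        · rw [← h0]
          simpa using hgpos x
        · have := mul_pos h0 (hhpos x)
          have := mul_nonneg (sub_nonneg.2 h1.2) (hgpos x).le
          linarith
      simp only [D, hne]
      linarith
    · have h1 := hgc x (Metric.mem_closedBall.2 (hψ0 x hne).le)
      have h2 := hχnorm x (by linarith [hψnorm x hne])
      have h3 := abs_le.1 hs
      have h4 := ψ.nonneg (x := x)
      have h5 := ψ.le_one (x := x)
      simp only [D, h2]
      nlinarith
  · have h1 : ψ x = 0 := by
      by_contra hne
      linarith [hψnorm x hne, norm_le_one_of_mem_doubleCube hx]
    simp [D, h1, hχ1 x hx]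
  · rw [integral_add hDint (ψ.integrable.const_mul s), integral_const_mul,
      div_mul_cancel₀ _ hI.ne', add_neg_cancel]

theorem contDiff_indicator_of_eq_zero_near_frontier {E : Type*} [NormedAddCommGroup E]
    [NormedSpace ℝ E] {k : ℕ} {Q W : Set E} (hQ : IsClosed Q) (hW : IsOpen W)
    (hQW : frontier Q ⊆ W) {f : E → ℝ} (hf : ContDiff ℝ k f) (hfW : ∀ x ∈ W, f x = 0) :
    ContDiff ℝ k (Q.indicator f) := by
  rw [contDiff_iff_contDiffAt]
  intro x
  by_cases hxW : x ∈ W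
  · refine contDiffAt_const (c := (0 : ℝ)) |>.congr_of_eventuallyEq ?_
    filter_upwards [hW.mem_nhds hxW] with y hy
    simp [hfW y hy]
  · by_cases hxQ : x ∈ Q
    · have hxi : x ∈ interior Q := by
        by_contra hxi
        exact hxW (hQW (hQ.frontier_eq ▸ ⟨hxQ, hxi⟩))
      refine hf.contDiffAt.congr_of_eventuallyEq ?_
      filter_upwards [mem_interior_iff_mem_nhds.1 hxi] with y hy
      simp [hy]
    · refine contDiffAt_const (c := (0 : ℝ)) |>.congr_of_eventuallyEq ?_
      filter_upwards [hQ.isOpen_compl.mem_nhds hxQ] with y hy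
      exact indicator_of_notMem hy f

theorem exists_inner_box {m : ℕ} {K : Set (ℝ × (Fin m → ℝ))} (hK : IsCompact K)
    (hKQ : K ⊆ interior (doubleCube m)) :
    ∃ a b : ℝ × (Fin m → ℝ), a.1 < b.1 ∧ (∀ i, a.2 i < b.2 i) ∧ K ⊆ Icc a b ∧
      Icc a b ⊆ interior (doubleCube m) := by
  obtain ⟨δ₀, hδ₀, hsub⟩ := hK.exists_cthickening_subset_open isOpen_interior hKQ
  let δ := min δ₀ (1 / 4)
  have hδ : 0 < δ := by positivity
  have hδ4 : δ ≤ 1 / 4 := min_le_right _ _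
  have hmem : ∀ x ∈ K, ∀ v : ℝ × (Fin m → ℝ), ‖v‖ ≤ δ → x + v ∈ doubleCube m :=
    fun x hx v hv => interior_subset (hsub (Metric.mem_cthickening_of_dist_le _ x _ _ hx (by
      rw [dist_eq_norm, add_sub_cancel_left]
      exact hv.trans (min_le_left _ _))))
  have hnorm : ∀ r : ℝ, |r| ≤ δ → ‖((r, fun _ => r) : ℝ × (Fin m → ℝ))‖ ≤ δ := fun r hr =>
    norm_prod_le_iff.2 ⟨hr, (pi_norm_le_iff_of_nonneg hδ.le).2 fun _ => hr⟩
  refine ⟨(-1 + δ, fun _ => δ), (1 - δ, fun _ => 1 - δ), by simp only; linarith,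
    fun i => by simp only; linarith, fun x hx => ?_, fun x hx => ?_⟩
  · have h1 := hmem x hx _ (hnorm δ (abs_of_pos hδ).le)
    have h2 := hmem x hx _ (hnorm (-δ) (by rw [abs_neg, abs_of_pos hδ]))
    have h3 : -1 ≤ x.1 + -δ := h2.1.1
    have h4 : x.1 + δ ≤ 1 := h1.1.2
    have h5 : ∀ i, 0 ≤ x.2 i + -δ := fun i => h2.2.1 i
    have h6 : ∀ i, x.2 i + δ ≤ 1 := fun i => h1.2.2 i
    refine ⟨⟨?_, fun i => ?_⟩, ⟨?_, fun i => ?_⟩⟩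
    · change -1 + δ ≤ x.1
      linarith
    · change δ ≤ x.2 i
      linarith [h5 i]
    · change x.1 ≤ 1 - δ
      linarith
    · change x.2 i ≤ 1 - δ
      linarith [h6 i]
  · have hopen : IsOpen (Ioo (-1 : ℝ) 1 ×ˢ (univ : Set (Fin m)).pi fun _ => Ioo (0 : ℝ) 1) :=
      isOpen_Ioo.prod (isOpen_set_pi finite_univ fun _ _ => isOpen_Ioo)
    refine interior_maximal (fun y hy => ?_) hopen ?_
    · exact ⟨Ioo_subset_Icc_self hy.1, fun i => (hy.2 i trivial).1.le,
        fun i => (hy.2 i trivial).2.le⟩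
    · have h3 : -1 + δ ≤ x.1 := hx.1.1
      have h4 : x.1 ≤ 1 - δ := hx.2.1
      have h5 : ∀ i, δ ≤ x.2 i := fun i => hx.1.2 i
      have h6 : ∀ i, x.2 i ≤ 1 - δ := fun i => hx.2.2 i
      exact ⟨⟨by linarith, by linarith⟩, fun i _ => ⟨by linarith [h5 i], by linarith [h6 i]⟩⟩

/-- **Moser's lemma for the double cube** `Q = [-1,1] × [0,1]^(n-1)` (here `n = m + 1`).
If `h, g > 0` are `C^k` on `ℝⁿ`, agree on `∂Q`, and have equal integrals over `Q` and
over the unit subcube `[0,1]ⁿ`, then there is a `C^k` diffeomorphism `u` of `ℝⁿ` with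
`g(u(x)) · det(Du(x)) = h(x)` on `Q`; moreover, if `h - g ≡ 0` near `∂Q`, then `u` may
be chosen to be the identity near `∂Q`. -/
theorem moser_double_cube (m k : ℕ) (hk : 1 ≤ k)
    (h g : ℝ × (Fin m → ℝ) → ℝ)
    (hh : ContDiff ℝ (k : ℕ∞) h) (hg : ContDiff ℝ (k : ℕ∞) g)
    (hhpos : ∀ x, 0 < h x) (hgpos : ∀ x, 0 < g x)
    (hbdry : ∀ x ∈ frontier (doubleCube m), h x = g x)
    (hintQ : ∫ x in doubleCube m, h x = ∫ x in doubleCube m, g x)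
    (hintR : ∫ x in rightCube m, h x = ∫ x in rightCube m, g x) :
    ∃ u : ℝ × (Fin m → ℝ) → ℝ × (Fin m → ℝ),
      (ContDiff ℝ (k : ℕ∞) u ∧
        (∃ w, ContDiff ℝ (k : ℕ∞) w ∧ Function.LeftInverse w u ∧ Function.RightInverse w u) ∧
        (∀ x ∈ doubleCube m, g (u x) * LinearMap.det (fderiv ℝ u x).toLinearMap = h x)) ∧
      ((∃ W : Set (ℝ × (Fin m → ℝ)), IsOpen W ∧ frontier (doubleCube m) ⊆ W ∧
          ∀ x ∈ W, h x = g x) →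
        ∃ u' : ℝ × (Fin m → ℝ) → ℝ × (Fin m → ℝ),
          (ContDiff ℝ (k : ℕ∞) u' ∧
            (∃ w, ContDiff ℝ (k : ℕ∞) w ∧
              Function.LeftInverse w u' ∧ Function.RightInverse w u') ∧
            (∀ x ∈ doubleCube m, g (u' x) * LinearMap.det (fderiv ℝ u' x).toLinearMap = h x)) ∧
          ∃ W : Set (ℝ × (Fin m → ℝ)), IsOpen W ∧ frontier (doubleCube m) ⊆ W ∧
            ∀ x ∈ W, u' x = x) := by
  have hQ := isCompact_doubleCube m
  obtain ⟨d, hdc, hd, hgd, hgdQ, hdint⟩ := exists_compact_correction hh hg hhpos hgpos hintQ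
  obtain ⟨u, hu, hw, hdet, -⟩ := transports_prod_of_integral_eq_zero hk
    (a := (-10, fun _ => -10)) (b := (10, fun _ => 10)) (by norm_num) (fun i => by norm_num)
    hdc hg hgpos hgd (fun x hx => hd x (by
      by_contra! hle
      exact hx (mem_Icc_of_norm_le hle))) hdint
  refine ⟨u, ⟨hu, hw, fun x hx => (hdet x).trans (hgdQ x hx)⟩, ?_⟩
  rintro ⟨W, hW, hQW, hhg⟩
  obtain ⟨a, b, hab₁, hab₂, hKB, hBQ⟩ := exists_inner_box (hQ.diff hW) fun x hx => by
    by_contra hxi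
    exact hx.2 (hQW (hQ.isClosed.frontier_eq ▸ ⟨hx.1, hxi⟩))
  let D := (doubleCube m).indicator fun x => h x - g x
  obtain ⟨u', hu', hw', hdet', hid'⟩ := transports_prod_of_integral_eq_zero hk (d := D)
    hab₁ hab₂ (contDiff_indicator_of_eq_zero_near_frontier hQ.isClosed hW hQW
      (hh.sub hg) fun x hx => sub_eq_zero.2 (hhg x hx)) hg hgpos
    (fun x => by
      by_cases hx : x ∈ doubleCube m
      · simpa [D, hx] using hhpos x
      · simpa [D, hx] using hgpos x)
    (fun x hx => by
      by_cases hxQ : x ∈ doubleCube m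
      · have hxW : x ∈ W := by
          by_contra hxW
          exact hx (hKB ⟨hxQ, hxW⟩)
        simp [D, hhg x hxW]
      · simp [D, hxQ])
    (integral_indicator_sub_eq_zero hQ hh.continuous hg.continuous hintQ)
  refine ⟨u', ⟨hu', hw', fun x hx => ?_⟩, (Icc a b)ᶜ, isClosed_Icc.isOpen_compl,
    fun x hx hxB => hx.2 (hBQ hxB), hid'⟩
  rw [hdet' x]
  simp [D, hx]
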